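/- arXiv:2211.15879 — 2 statements merged into one kernel-verified Lean document; each statement's English description precedes it below -/
import Mathlib

section
/- For every integer k ≥ 1, the linear map sending a homogeneous harmonic polynomial q ∈ P_k to the vector field x ↦ x × ∇q(x) is a linear isomorphism from P_k onto W_k^o; in particular, for every q ∈ P_k the field x × ∇q has components that are homogeneous harmonic polynomials of degree k, is divergence-free on ℝ³, and its Kelvin transform is divergence-free on ℝ³∖{0}. -/
noncomputable section

open scoped BigOperators

/-- Points of `ℝ³`. -/
abbrev V3 : Type := Fin 3 → ℝ

/-- The Euclidean inner product on `ℝ³`. -/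
def dot3 (x y : V3) : ℝ := ∑ i, x i * y i

/-- The Euclidean norm on `ℝ³`. -/
def norm3 (x : V3) : ℝ := Real.sqrt (dot3 x x)

/-- The cross product on `ℝ³` (cyclic formula, `(x × y) i = x (i+1) y (i+2) - x (i+2) y (i+1)`). -/
def cross3 (x y : V3) : V3 := fun i => x (i + 1) * y (i + 2) - x (i + 2) * y (i + 1)

/-- Partial derivative in the `i`-th coordinate direction. -/
def pd (i : Fin 3) (f : V3 → ℝ) (x : V3) : ℝ := fderiv ℝ f x (Pi.single i 1)

/-- Gradient of a scalar field. -/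
def grad3 (f : V3 → ℝ) (x : V3) : V3 := fun i => pd i f x

/-- Divergence of a vector field. -/
def div3 (p : V3 → V3) (x : V3) : ℝ := ∑ i, pd i (fun y => p y i) x

/-- Curl of a vector field. -/
def curl3 (p : V3 → V3) (x : V3) : V3 :=
  fun i => pd (i + 1) (fun y => p y (i + 2)) x - pd (i + 2) (fun y => p y (i + 1)) x

/-- `f` is the function of a homogeneous polynomial of degree `k` on `ℝ³`. -/
def IsHomogPoly (k : ℕ) (f : V3 → ℝ) : Prop :=
  ∃ q : MvPolynomial (Fin 3) ℝ, q.IsHomogeneous k ∧ ∀ x, f x = MvPolynomial.eval x q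

/-- `f` is harmonic (its Laplacian vanishes) on all of `ℝ³`. -/
def IsHarmonic (f : V3 → ℝ) : Prop := ∀ x, ∑ i, pd i (pd i f) x = 0

/-- `P_k`: homogeneous harmonic polynomials of degree `k` (as functions on `ℝ³`). -/
def Pk (k : ℕ) : Set (V3 → ℝ) := {f | IsHomogPoly k f ∧ IsHarmonic f}

/-- `P_k³`: vector fields all of whose components lie in `P_k`. -/
def Pk3 (k : ℕ) : Set (V3 → V3) := {p | ∀ i, (fun x => p x i) ∈ Pk k}

/-- Kelvin transform of a degree-`k` homogeneous field: `p*(x) = |x|^{-(2k+1)} p(x)`. -/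
def kelvin (k : ℕ) (p : V3 → V3) : V3 → V3 := fun x => (norm3 x ^ (2 * k + 1))⁻¹ • p x

/-- `W_k^o`: fields in `P_k³` that are divergence free on `ℝ³` and whose Kelvin transform
is divergence free on `ℝ³ \ {0}`. -/
def Wko (k : ℕ) : Set (V3 → V3) :=
  {p | p ∈ Pk3 k ∧ (∀ x, div3 p x = 0) ∧ ∀ x : V3, x ≠ 0 → div3 (kelvin k p) x = 0}

/-- `W_k^-`: fields in `P_k³` that are divergence free and curl free on `ℝ³`. -/
def Wkm (k : ℕ) : Set (V3 → V3) :=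
  {p | p ∈ Pk3 k ∧ (∀ x, div3 p x = 0) ∧ ∀ x, curl3 p x = 0}

/-- `W_k^+`: fields in `P_k³` whose Kelvin transform is divergence free and curl free
on `ℝ³ \ {0}`. -/
def Wkp (k : ℕ) : Set (V3 → V3) :=
  {p | p ∈ Pk3 k ∧ (∀ x : V3, x ≠ 0 → div3 (kelvin k p) x = 0) ∧
    ∀ x : V3, x ≠ 0 → curl3 (kelvin k p) x = 0}

/-- The map `q ↦ (x ↦ x × ∇q(x))`. -/
def crossGradMap (q : V3 → ℝ) : V3 → V3 := fun x => cross3 x (grad3 q x)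

section Polynomials

open MvPolynomial

/-- Polynomials in three real variables. -/
abbrev Poly3 : Type := MvPolynomial (Fin 3) ℝ

theorem sum_fin_three_cyclic {M : Type*} [AddCommMonoid M] (f : Fin 3 → M) (i : Fin 3) :
    ∑ j, f j = f i + f (i + 1) + f (i + 2) := by
  rw [← Equiv.sum_comp (Equiv.addLeft i) f, Fin.sum_univ_three]
  simp

theorem pderiv_pderiv_comm {σ R : Type*} [CommSemiring R] (i j : σ) (q : MvPolynomial σ R) :
    pderiv i (pderiv j q) = pderiv j (pderiv i q) := by
  classical
  ext m
  by_cases h : i = j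
  · rw [h]
  · simp only [coeff_pderiv, Finsupp.add_apply, Finsupp.single_apply, if_neg h,
      if_neg (Ne.symm h), add_zero, add_right_comm m]
    ring

theorem hasFDerivAt_eval (q : Poly3) (x : V3) :
    HasFDerivAt (fun y : V3 => eval y q)
      (∑ i, eval x (pderiv i q) • ContinuousLinearMap.proj (R := ℝ) (φ := fun _ : Fin 3 => ℝ) i)
      x := by
  induction q using MvPolynomial.induction_on with
  | C a => simpa using hasFDerivAt_const a x
  | add p q hp hq =>
    convert! hp.add hq using 1
    · ext y
      simp
    · simp [add_smul, Finset.sum_add_distrib]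
  | mul_X p j hp =>
    have hX : HasFDerivAt (fun y : V3 => y j)
        (ContinuousLinearMap.proj (R := ℝ) (φ := fun _ : Fin 3 => ℝ) j) x :=
      hasFDerivAt_apply j x
    convert! hp.mul hX using 1
    · ext y
      simp
    · ext v
      simp [pderiv_X, Pi.single_apply, Finset.sum_add_distrib, add_mul, Finset.mul_sum, apply_ite,
        mul_assoc]

theorem pd_eval (i : Fin 3) (q : Poly3) :
    pd i (fun x => eval x q) = fun x => eval x (pderiv i q) := by
  ext x
  simp [pd, (hasFDerivAt_eval q x).fderiv, Pi.single_apply]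

theorem differentiableAt_eval (q : Poly3) (x : V3) :
    DifferentiableAt ℝ (fun y : V3 => eval y q) x :=
  (hasFDerivAt_eval q x).differentiableAt

/-- The Laplacian of a polynomial. -/
def polyLaplacian : Poly3 →ₗ[ℝ] Poly3 :=
  ∑ i, (pderiv i).toLinearMap ∘ₗ (pderiv i).toLinearMap

theorem polyLaplacian_apply (q : Poly3) : polyLaplacian q = ∑ i, pderiv i (pderiv i q) := by
  simp [polyLaplacian]

/-- The `i`-th component of `x × ∇q`. -/
def angular (i : Fin 3) : Derivation ℝ Poly3 Poly3 :=
  (X (i + 1) : Poly3) • pderiv (i + 2) - (X (i + 2) : Poly3) • pderiv (i + 1)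

theorem angular_apply (i : Fin 3) (q : Poly3) :
    angular i q = X (i + 1) * pderiv (i + 2) q - X (i + 2) * pderiv (i + 1) q := rfl

theorem eval_injective : Function.Injective fun (q : Poly3) (x : V3) => eval x q :=
  fun _ _ h => MvPolynomial.funext fun x => congrFun h x

theorem mem_Pk_iff {k : ℕ} {f : V3 → ℝ} :
    f ∈ Pk k ↔ ∃ q : Poly3, q.IsHomogeneous k ∧ polyLaplacian q = 0 ∧ f = fun x => eval x q := by
  have key (q : Poly3) : IsHarmonic (fun x => eval x q) ↔ polyLaplacian q = 0 := by
    rw [← eval_injective.eq_iff, funext_iff]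
    simp [IsHarmonic, pd_eval, polyLaplacian_apply]
  constructor
  · rintro ⟨⟨q, hq, hf⟩, hh⟩
    obtain rfl : f = fun x => eval x q := funext hf
    exact ⟨q, hq, (key q).1 hh, rfl⟩
  · rintro ⟨q, hq, hl, rfl⟩
    exact ⟨⟨q, hq, fun _ => rfl⟩, (key q).2 hl⟩

theorem crossGradMap_eval (q : Poly3) :
    crossGradMap (fun x => eval x q) = fun x i => eval x (angular i q) := by
  ext x i
  simp [crossGradMap, cross3, grad3, pd_eval, angular_apply]

theorem div3_eval (P : Fin 3 → Poly3) (x : V3) :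
    div3 (fun x i => eval x (P i)) x = eval x (∑ i, pderiv i (P i)) := by
  simp [div3, pd_eval]

theorem dot3_self_pos {x : V3} (hx : x ≠ 0) : 0 < dot3 x x := by
  obtain ⟨j, hj⟩ := Function.ne_iff.1 hx
  exact Finset.sum_pos' (fun i _ => mul_self_nonneg (x i))
    ⟨j, Finset.mem_univ j, mul_self_pos.2 hj⟩

theorem pd_inv_norm3_pow (n : ℕ) (i : Fin 3) {x : V3} (hx : x ≠ 0) :
    DifferentiableAt ℝ (fun y => (norm3 y ^ n)⁻¹) x ∧
      pd i (fun y => (norm3 y ^ n)⁻¹) x = -(n * x i / (dot3 x x * norm3 x ^ n)) := by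
  have hpos := dot3_self_pos hx
  have hs : (fun y : V3 => dot3 y y) = fun y => eval y (∑ j, X j * X j : Poly3) := by
    ext y
    simp [dot3]
  have hd : HasFDerivAt (fun y : V3 => dot3 y y) _ x := hs ▸ hasFDerivAt_eval _ x
  have hn : norm3 x ≠ 0 := (Real.sqrt_pos.2 hpos).ne'
  have h : HasFDerivAt (fun y => (norm3 y ^ n)⁻¹) _ x :=
    (hasDerivAt_inv (pow_ne_zero n hn)).comp_hasFDerivAt x ((hd.sqrt hpos.ne').pow n)
  refine ⟨h.differentiableAt, ?_⟩
  have hsq : dot3 x x = norm3 x ^ 2 := (Real.sq_sqrt hpos.le).symm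
  have hnorm : √(dot3 x x) = norm3 x := rfl
  rw [pd, h.fderiv, hnorm, hsq]
  have hX : eval x (pderiv i (∑ j, X j * X j : Poly3)) = 2 * x i := by
    rw [map_sum, Finset.sum_eq_single i]
    · simp [two_mul]
    · intro j _ hj
      simp [pderiv_X_of_ne hj]
    · simp
  rcases n with _ | n
  · simp
  · simp [Pi.single_apply, -map_sum, hX]
    field_simp
    ring

theorem div3_kelvin_eval (k : ℕ) (P : Fin 3 → Poly3) {x : V3} (hx : x ≠ 0) :
    div3 (kelvin k fun x i => eval x (P i)) x =
      (norm3 x ^ (2 * k + 1))⁻¹ * (eval x (∑ i, pderiv i (P i)) -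
        (2 * k + 1) / dot3 x x * eval x (∑ i, X i * P i)) := by
  have h (i : Fin 3) : pd i (fun y => kelvin k (fun x i => eval x (P i)) y i) x =
      (norm3 x ^ (2 * k + 1))⁻¹ * (eval x (pderiv i (P i)) -
        (2 * k + 1) / dot3 x x * eval x (X i * P i)) := by
    obtain ⟨hd, hp⟩ := pd_inv_norm3_pow (2 * k + 1) i hx
    have he := congrFun (pd_eval i (P i)) x
    simp only [pd] at hp he
    simp only [pd, kelvin, Pi.smul_apply, smul_eq_mul]
    rw [fderiv_fun_mul hd (differentiableAt_eval (P i) x)]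
    simp only [add_apply, smul_apply, smul_eq_mul, hp, he,
      eval_mul, eval_X]
    push_cast
    ring
  simp only [div3, h, ← Finset.mul_sum, Finset.sum_sub_distrib, map_sum]

theorem mem_Wko_iff {k : ℕ} {p : V3 → V3} :
    p ∈ Wko k ↔ ∃ P : Fin 3 → Poly3, (∀ i, (P i).IsHomogeneous k) ∧
      (∀ i, polyLaplacian (P i) = 0) ∧ ∑ i, pderiv i (P i) = 0 ∧ ∑ i, X i * P i = 0 ∧
      p = fun x i => eval x (P i) := by
  constructor
  · rintro ⟨hp, hdiv, hkel⟩
    choose P hhom hlap hP using fun i => mem_Pk_iff.1 (hp i)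
    obtain rfl : p = fun x i => eval x (P i) := by
      ext x i
      exact congrFun (hP i) x
    have hD : ∑ i, pderiv i (P i) = 0 := MvPolynomial.funext fun x => by
      rw [← div3_eval, hdiv, map_zero]
    refine ⟨P, hhom, hlap, hD, MvPolynomial.funext fun x => ?_, rfl⟩
    by_cases hx : x = 0
    · simp [hx]
    · have h := hkel x hx
      have hpos := dot3_self_pos hx
      have hn : norm3 x ≠ 0 := (Real.sqrt_pos.2 hpos).ne'
      have hk : (2 * k + 1 : ℝ) ≠ 0 := by positivity
      rw [div3_kelvin_eval k P hx, hD] at h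
      simpa [hn, hpos.ne', hk] using h
  · rintro ⟨P, hhom, hlap, hD, hS, rfl⟩
    refine ⟨fun i => mem_Pk_iff.2 ⟨P i, hhom i, hlap i, rfl⟩, fun x => ?_, fun x hx => ?_⟩
    · rw [div3_eval, hD, map_zero]
    · rw [div3_kelvin_eval k P hx, hD, hS]
      simp

theorem isHomogeneous_angular {k : ℕ} (hk : 1 ≤ k) {q : Poly3} (hq : q.IsHomogeneous k)
    (i : Fin 3) : (angular i q).IsHomogeneous k := by
  have h (j l : Fin 3) : (X j * pderiv l q).IsHomogeneous k := by
    have := (isHomogeneous_X ℝ j).mul (hq.pderiv (i := l))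
    rwa [Nat.add_sub_cancel' hk] at this
  exact (h _ _).sub (h _ _)

theorem fin_three_cyclic (i : Fin 3) :
    i + 1 ≠ i ∧ i + 2 ≠ i ∧ i ≠ i + 1 ∧ i ≠ i + 2 ∧ i + 1 ≠ i + 2 ∧ i + 2 ≠ i + 1 ∧
      i + 1 + 1 = i + 2 ∧ i + 1 + 2 = i ∧ i + 2 + 1 = i ∧ i + 2 + 2 = i + 1 := by
  revert i
  decide

theorem polyLaplacian_angular (i : Fin 3) (q : Poly3) :
    polyLaplacian (angular i q) = angular i (polyLaplacian q) := by
  obtain ⟨h1, h2, h3, h4, h5, h6, h7, h8, h9, h10⟩ := fin_three_cyclic i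
  simp only [polyLaplacian_apply, angular_apply, sum_fin_three_cyclic _ i, map_add, map_sub,
    pderiv_mul, pderiv_X_self, pderiv_X_of_ne, ne_eq, not_false_eq_true, *]
  simp only [pderiv_pderiv_comm (i + 1) i, pderiv_pderiv_comm (i + 2) i,
    pderiv_pderiv_comm (i + 2) (i + 1), map_zero, pderiv_one]
  ring

theorem sum_pderiv_angular (q : Poly3) : ∑ i, pderiv i (angular i q) = 0 := by
  obtain ⟨i⟩ : Nonempty (Fin 3) := inferInstance
  obtain ⟨h1, h2, h3, h4, h5, h6, h7, h8, h9, h10⟩ := fin_three_cyclic i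
  simp only [angular_apply, sum_fin_three_cyclic _ i, map_sub,
    pderiv_mul, pderiv_X_of_ne, ne_eq, not_false_eq_true, *]
  simp only [pderiv_pderiv_comm (i + 1) i, pderiv_pderiv_comm (i + 2) i,
    pderiv_pderiv_comm (i + 2) (i + 1)]
  ring

theorem sum_X_mul_angular (q : Poly3) : ∑ i, X i * angular i q = 0 := by
  obtain ⟨-, -, -, -, -, -, h7, h8, h9, h10⟩ := fin_three_cyclic 0
  simp only [sum_fin_three_cyclic _ 0, angular_apply, *]
  ring

/-- The curl of a polynomial vector field. -/
def polyCurl (P : Fin 3 → Poly3) (i : Fin 3) : Poly3 :=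
  pderiv (i + 1) (P (i + 2)) - pderiv (i + 2) (P (i + 1))

theorem sum_angular_eq_sum_X_mul_polyCurl (P : Fin 3 → Poly3) :
    ∑ i, angular i (P i) = ∑ i, X i * polyCurl P i := by
  obtain ⟨-, -, -, -, -, -, h7, h8, h9, h10⟩ := fin_three_cyclic 0
  simp only [sum_fin_three_cyclic _ 0, angular_apply, polyCurl, *]
  ring

/-- Euler's identity for the first partial derivatives. -/
theorem sum_X_mul_pderiv_pderiv {k : ℕ} (hk : 1 ≤ k) {q : Poly3} (hq : q.IsHomogeneous k)
    (j : Fin 3) : ∑ i, X i * pderiv i (pderiv j q) = ((k : Poly3) - 1) * pderiv j q := by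
  rw [(hq.pderiv (i := j)).sum_X_mul_pderiv, nsmul_eq_mul, Nat.cast_pred hk]

theorem polyCurl_angular {k : ℕ} (hk : 1 ≤ k) {q : Poly3} (hq : q.IsHomogeneous k)
    (hlap : polyLaplacian q = 0) (i : Fin 3) :
    polyCurl (fun j => angular j q) i = -((k : Poly3) + 1) * pderiv i q := by
  obtain ⟨h1, h2, h3, h4, h5, h6, h7, h8, h9, h10⟩ := fin_three_cyclic i
  have hE := sum_X_mul_pderiv_pderiv hk hq i
  rw [polyLaplacian_apply] at hlap
  simp only [sum_fin_three_cyclic _ i] at hE hlap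
  simp only [polyCurl, angular_apply, map_sub, pderiv_mul, pderiv_X_self, pderiv_X_of_ne, ne_eq,
    not_false_eq_true, h3, h4, h7, h8, h9, h10]
  simp only [pderiv_pderiv_comm (i + 1) i, pderiv_pderiv_comm (i + 2) i] at hE ⊢
  linear_combination X i * hlap - hE

theorem pderiv_sum_X_mul_polyCurl {k : ℕ} (hk : 1 ≤ k) {P : Fin 3 → Poly3}
    (hhom : ∀ i, (P i).IsHomogeneous k) (hlap : ∀ i, polyLaplacian (P i) = 0)
    (hD : ∑ i, pderiv i (P i) = 0) (i : Fin 3) :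
    pderiv i (∑ j, X j * polyCurl P j) = (k : Poly3) * polyCurl P i := by
  obtain ⟨h1, h2, h3, h4, h5, h6, h7, h8, h9, h10⟩ := fin_three_cyclic i
  have hE₁ := sum_X_mul_pderiv_pderiv hk (hhom (i + 2)) (i + 1)
  have hE₂ := sum_X_mul_pderiv_pderiv hk (hhom (i + 1)) (i + 2)
  have hL₁ := hlap (i + 1)
  have hL₂ := hlap (i + 2)
  have hD₁ := congrArg (pderiv (i + 1)) hD
  have hD₂ := congrArg (pderiv (i + 2)) hD
  simp only [polyLaplacian_apply, sum_fin_three_cyclic _ i, map_add, map_zero]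
    at hE₁ hE₂ hL₁ hL₂ hD₁ hD₂
  simp only [polyCurl, sum_fin_three_cyclic _ i, map_add, map_sub, pderiv_mul, pderiv_X_self,
    pderiv_X_of_ne, ne_eq, not_false_eq_true, h1, h2, h7, h8, h9, h10]
  simp only [pderiv_pderiv_comm (i + 1) i, pderiv_pderiv_comm (i + 2) i,
    pderiv_pderiv_comm (i + 2) (i + 1)] at hE₁ hE₂ hD₁ hD₂ ⊢
  linear_combination hE₁ - hE₂ + X (i + 2) * (hL₁ - hD₁) - X (i + 1) * (hL₂ - hD₂)

theorem X_cross_polyCurl {k : ℕ} {P : Fin 3 → Poly3} (hhom : ∀ i, (P i).IsHomogeneous k)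
    (hS : ∑ i, X i * P i = 0) (i : Fin 3) :
    X (i + 1) * polyCurl P (i + 2) - X (i + 2) * polyCurl P (i + 1) =
      -((k : Poly3) + 1) * P i := by
  obtain ⟨h1, h2, h3, h4, h5, h6, h7, h8, h9, h10⟩ := fin_three_cyclic i
  have hE := (hhom i).sum_X_mul_pderiv
  have hS' := congrArg (pderiv i) hS
  simp only [sum_fin_three_cyclic _ i, map_add, map_zero, pderiv_mul, pderiv_X_self,
    pderiv_X_of_ne, ne_eq, not_false_eq_true, h1, h2, nsmul_eq_mul] at hE hS'
  simp only [polyCurl, h7, h8, h9, h10]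
  linear_combination hS' - hE

theorem angular_sum_angular {k : ℕ} (hk : 1 ≤ k) {P : Fin 3 → Poly3}
    (hhom : ∀ i, (P i).IsHomogeneous k) (hlap : ∀ i, polyLaplacian (P i) = 0)
    (hD : ∑ i, pderiv i (P i) = 0) (hS : ∑ i, X i * P i = 0) (i : Fin 3) :
    angular i (∑ j, angular j (P j)) = (-(k * (k + 1)) : ℝ) • P i := by
  have h := X_cross_polyCurl hhom hS i
  rw [angular_apply, sum_angular_eq_sum_X_mul_polyCurl, smul_eq_C_mul]
  simp only [pderiv_sum_X_mul_polyCurl hk hhom hlap hD, C_neg, C_mul, C_add, C_1, map_natCast]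
  linear_combination (k : Poly3) * h

theorem eq_zero_of_angular_eq_zero {k : ℕ} (hk : 1 ≤ k) {q : Poly3} (hq : q.IsHomogeneous k)
    (hlap : polyLaplacian q = 0) (h : ∀ i, angular i q = 0) : q = 0 := by
  have hgrad (i : Fin 3) : pderiv i q = 0 := by
    have hi := polyCurl_angular hk hq hlap i
    simp only [polyCurl, h, map_zero, sub_zero, zero_eq_mul, neg_eq_zero] at hi
    exact hi.resolve_left (Nat.cast_add_one_ne_zero k)
  have hE := hq.sum_X_mul_pderiv
  simp only [hgrad, mul_zero, Finset.sum_const_zero] at hE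
  exact (smul_eq_zero.1 hE.symm).resolve_left (by lia)

end Polynomials

/-- For `k ≥ 1`, `q ↦ x × ∇q` is a linear isomorphism from `P_k` onto
`W_k^o`; in particular, for every `q ∈ P_k` the field `x × ∇q` lies in `W_k^o`, i.e. its
components are homogeneous harmonic polynomials of degree `k`, it is divergence free on `ℝ³`,
and its Kelvin transform is divergence free on `ℝ³ \ {0}`. -/
theorem crossGradMap_linear_iso (k : ℕ) (hk : 1 ≤ k) :
    (∀ q ∈ Pk k, crossGradMap q ∈ Wko k) ∧
    (∀ q ∈ Pk k, ∀ q' ∈ Pk k, crossGradMap q = crossGradMap q' → q = q') ∧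
    (∀ p ∈ Wko k, ∃ q ∈ Pk k, crossGradMap q = p) ∧
    (∀ q ∈ Pk k, ∀ q' ∈ Pk k, crossGradMap (q + q') = crossGradMap q + crossGradMap q') ∧
    (∀ (c : ℝ), ∀ q ∈ Pk k, crossGradMap (c • q) = c • crossGradMap q) := by
  refine ⟨?_, ?_, ?_, ?_, ?_⟩
  · intro q hq
    obtain ⟨q, hhom, hlap, rfl⟩ := mem_Pk_iff.1 hq
    exact mem_Wko_iff.2 ⟨fun i => angular i q, isHomogeneous_angular hk hhom,
      fun i => by rw [polyLaplacian_angular, hlap, map_zero], sum_pderiv_angular q,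
      sum_X_mul_angular q, crossGradMap_eval q⟩
  · intro q hq q' hq' h
    obtain ⟨q, hhom, hlap, rfl⟩ := mem_Pk_iff.1 hq
    obtain ⟨q', hhom', hlap', rfl⟩ := mem_Pk_iff.1 hq'
    rw [crossGradMap_eval, crossGradMap_eval] at h
    have hzero : q - q' = 0 := by
      refine eq_zero_of_angular_eq_zero hk (hhom.sub hhom') (by rw [map_sub, hlap, hlap', sub_zero])
        fun i => ?_
      rw [map_sub, sub_eq_zero]
      exact MvPolynomial.funext fun x => congrFun (congrFun h x) i
    rw [sub_eq_zero.1 hzero]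
  · intro p hp
    obtain ⟨P, hhom, hlap, hD, hS, rfl⟩ := mem_Wko_iff.1 hp
    have hc : (-(k * (k + 1)) : ℝ) ≠ 0 := neg_ne_zero.2 (by positivity)
    let q : Poly3 := (-(k * (k + 1)) : ℝ)⁻¹ • ∑ j, angular j (P j)
    refine ⟨fun x => MvPolynomial.eval x q, mem_Pk_iff.2 ⟨q, ?_, ?_, rfl⟩, ?_⟩
    · exact (MvPolynomial.homogeneousSubmodule (Fin 3) ℝ k).smul_mem _
        (MvPolynomial.IsHomogeneous.sum _ _ _ fun j _ => isHomogeneous_angular hk (hhom j) j)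
    · simp [q, polyLaplacian_angular, hlap]
    · have hq (i : Fin 3) : angular i q = P i := by
        rw [Derivation.map_smul, angular_sum_angular hk hhom hlap hD hS, inv_smul_smul₀ hc]
      simp only [crossGradMap_eval, hq]
  · intro q hq q' hq'
    obtain ⟨q, -, -, rfl⟩ := mem_Pk_iff.1 hq
    obtain ⟨q', -, -, rfl⟩ := mem_Pk_iff.1 hq'
    have h : ((fun x => MvPolynomial.eval x q) + fun x => MvPolynomial.eval x q') =
        fun x : V3 => MvPolynomial.eval x (q + q') := by
      ext x
      simp
    rw [h]
    simp only [crossGradMap_eval]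
    ext x i
    simp
  · intro c q hq
    obtain ⟨q, -, -, rfl⟩ := mem_Pk_iff.1 hq
    have h : (c • fun x => MvPolynomial.eval x q) =
        fun x : V3 => MvPolynomial.eval x (c • q) := by
      ext x
      simp [MvPolynomial.smul_eval]
    rw [h]
    simp only [crossGradMap_eval]
    ext x i
    simp [MvPolynomial.smul_eval]
end
end

section
/- Let k ≥ 1 and let p : ℝ³ → ℝ³ be a vector field whose components are homogeneous harmonic polynomials of degree k, such that ∇·p = 0 on ℝ³ and x·p(x) = 0 for all x ∈ ℝ³. Define q(x) := −(1/(k(k+1))) x·(∇×p)(x). Then q is a homogeneous harmonic polynomial of degree k, ∇q = −(1/(k+1)) ∇×p on ℝ³, and p(x) = x × ∇q(x) for all x ∈ ℝ³. -/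
noncomputable section

open scoped BigOperators

/-- The scalar potential `q(x) := -(1/(k(k+1))) x · (∇×p)(x)`. -/
def qOf (k : ℕ) (p : V3 → V3) : V3 → ℝ :=
  fun x => -(1 / ((k : ℝ) * ((k : ℝ) + 1))) * dot3 x (curl3 p x)

namespace MvPolynomial

theorem hasFDerivAt_eval {σ : Type*} [Fintype σ] (f : MvPolynomial σ ℝ)
    (x : σ → ℝ) :
    HasFDerivAt (fun y => eval y f)
      (∑ i, eval x (pderiv i f) • ContinuousLinearMap.proj (R := ℝ) (φ := fun _ : σ => ℝ) i) x := by
  classical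
  induction f using MvPolynomial.induction_on with
  | C a => simpa using hasFDerivAt_const a x
  | add f g hf hg =>
    simp only [map_add, add_smul, Finset.sum_add_distrib]
    exact hf.add hg
  | mul_X f j hf =>
    have h := hf.mul (hasFDerivAt_apply j x)
    simp only [map_mul, eval_X]
    refine h.congr_fderiv ?_
    ext v
    simp only [pderiv_mul, pderiv_X, Pi.single_apply, mul_ite, mul_one, mul_zero, map_add, map_mul,
      eval_X, apply_ite (eval x), map_zero, add_smul, Finset.sum_add_distrib, add_comm]
    simp [Finset.mul_sum, mul_comm, mul_left_comm]

theorem pderiv_comm {σ R : Type*} [CommRing R] (i j : σ) (f : MvPolynomial σ R) :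
    pderiv i (pderiv j f) = pderiv j (pderiv i f) := by
  classical
  have h : ⁅(pderiv i : Derivation R (MvPolynomial σ R) (MvPolynomial σ R)),
      (pderiv j : Derivation R (MvPolynomial σ R) (MvPolynomial σ R))⁆ = 0 := by
    refine derivation_ext fun l => ?_
    rw [Derivation.commutator_apply, pderiv_X, pderiv_X, Pi.single_apply, Pi.single_apply]
    split_ifs <;> simp
  have := DFunLike.congr_fun h f
  rwa [Derivation.commutator_apply, Derivation.zero_apply, sub_eq_zero] at this

/-- The curl of a polynomial vector field in three variables. -/
def curl (P : Fin 3 → MvPolynomial (Fin 3) ℝ) : Fin 3 → MvPolynomial (Fin 3) ℝ :=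
  fun i => pderiv (i + 1) (P (i + 2)) - pderiv (i + 2) (P (i + 1))

theorem IsHomogeneous.curl {P : Fin 3 → MvPolynomial (Fin 3) ℝ} {k : ℕ}
    (hP : ∀ i, (P i).IsHomogeneous k) (i : Fin 3) : (curl P i).IsHomogeneous (k - 1) :=
  (hP _).pderiv.sub (hP _).pderiv

theorem div_curl (P : Fin 3 → MvPolynomial (Fin 3) ℝ) : ∑ i, pderiv i (curl P i) = 0 := by
  simp only [curl, Fin.sum_univ_three, Fin.isValue, Fin.reduceAdd, map_sub, zero_add]
  rw [pderiv_comm 1 0, pderiv_comm 2 0, pderiv_comm 2 1]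
  ring

/-- A divergence-free harmonic field has an irrotational curl. -/
theorem pderiv_curl_comm {P : Fin 3 → MvPolynomial (Fin 3) ℝ}
    (hdiv : ∑ i, pderiv i (P i) = 0) (hharm : ∀ i, ∑ j, pderiv j (pderiv j (P i)) = 0)
    (i j : Fin 3) : pderiv i (curl P j) = pderiv j (curl P i) := by
  have hd (l : Fin 3) : pderiv l (∑ i, pderiv i (P i)) = 0 := by rw [hdiv, map_zero]
  have hd0 := hd 0
  have hd1 := hd 1
  have hd2 := hd 2
  have h0 := hharm 0
  have h1 := hharm 1
  have h2 := hharm 2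
  simp only [Fin.sum_univ_three, map_add] at hd0 hd1 hd2 h0 h1 h2
  rw [pderiv_comm 0 1, pderiv_comm 0 2] at hd0
  rw [pderiv_comm 1 2] at hd1
  have c10 := pderiv_comm (R := ℝ) (1 : Fin 3) 0
  have c20 := pderiv_comm (R := ℝ) (2 : Fin 3) 0
  have c21 := pderiv_comm (R := ℝ) (2 : Fin 3) 1
  fin_cases i <;> fin_cases j <;>
    simp only [curl, Fin.isValue, Fin.zero_eta, Fin.mk_one, Fin.reduceFinMk, Fin.reduceAdd,
      zero_add, map_sub] <;>
    grind

/-- The gradient of `x · C` for an irrotational field `C` homogeneous of degree `m`. -/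
theorem pderiv_sum_X_mul {σ : Type*} [Fintype σ] {C : σ → MvPolynomial σ ℝ} {m : ℕ}
    (hC : ∀ i, (C i).IsHomogeneous m) (hcomm : ∀ i j, pderiv i (C j) = pderiv j (C i))
    (i : σ) : pderiv i (∑ j, X j * C j) = (m + 1) • C i := by
  classical
  simp_rw [map_sum, pderiv_mul, Finset.sum_add_distrib, hcomm i, (hC i).sum_X_mul_pderiv,
    pderiv_X, Pi.single_apply, ite_mul, one_mul, zero_mul]
  simp [add_smul, add_comm]

/-- For a tangential field `P` homogeneous of degree `k`, `x × curl P = -(k + 1) P`. -/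
theorem cross_curl_of_tangential {P : Fin 3 → MvPolynomial (Fin 3) ℝ} {k : ℕ}
    (hP : ∀ i, (P i).IsHomogeneous k) (htan : ∑ i, X i * P i = 0) (i : Fin 3) :
    X (i + 1) * curl P (i + 2) - X (i + 2) * curl P (i + 1) = -((k + 1) • P i) := by
  have ht : pderiv i (∑ j, X j * P j) = 0 := by rw [htan, map_zero]
  have he := (hP i).sum_X_mul_pderiv
  simp only [Fin.sum_univ_three, map_add, pderiv_mul, pderiv_X, nsmul_eq_mul] at ht he ⊢
  push_cast
  fin_cases i <;>
    simp [curl] at ht he ⊢ <;>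
    linear_combination ht - he

end MvPolynomial

theorem pd_eval_s5 (i : Fin 3) (f : MvPolynomial (Fin 3) ℝ) :
    pd i (fun x => MvPolynomial.eval x f) =
      fun x => MvPolynomial.eval x (MvPolynomial.pderiv i f) := by
  funext x
  simp [pd, (MvPolynomial.hasFDerivAt_eval f x).fderiv, Pi.single_apply]

open MvPolynomial in
/-- If `k ≥ 1` and `p ∈ P_k³` satisfies `∇·p = 0` and `x·p(x) = 0` on `ℝ³`,
then `q(x) := -(1/(k(k+1))) x·(∇×p)(x)` is a homogeneous harmonic polynomial of degree `k`,
`∇q = -(1/(k+1)) ∇×p` on `ℝ³`, and `p(x) = x × ∇q(x)` for all `x`. -/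
theorem orbital_angular_momentum (k : ℕ) (hk : 1 ≤ k) (p : V3 → V3) (hp : p ∈ Pk3 k)
    (hdiv : ∀ x, div3 p x = 0) (htan : ∀ x, dot3 x (p x) = 0) :
    qOf k p ∈ Pk k ∧
    (∀ x, grad3 (qOf k p) x = (-(1 / ((k : ℝ) + 1))) • curl3 p x) ∧
    (∀ x, p x = cross3 x (grad3 (qOf k p) x)) := by
  have hk0 : (k : ℝ) ≠ 0 := by positivity
  have hk1 : (k : ℝ) + 1 ≠ 0 := by positivity
  choose P hP hpP using fun i => (hp i).1
  have hcomp (i : Fin 3) : (fun x => p x i) = fun x => eval x (P i) := funext (hpP i)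
  have hPharm (i : Fin 3) : ∑ j, pderiv j (pderiv j (P i)) = 0 := by
    refine MvPolynomial.funext fun x => ?_
    have := (hp i).2 x
    simpa only [hcomp, pd_eval_s5, map_sum, map_zero] using this
  have hPdiv : ∑ i, pderiv i (P i) = 0 := by
    refine MvPolynomial.funext fun x => ?_
    have := hdiv x
    simpa only [div3, hcomp, pd_eval_s5, map_sum, map_zero] using this
  have hPtan : ∑ i, X i * P i = 0 := by
    refine MvPolynomial.funext fun x => ?_
    have := htan x
    simpa only [dot3, hpP, map_sum, map_mul, eval_X, map_zero] using this
  have hcurl (x : V3) (i : Fin 3) : curl3 p x i = eval x (curl P i) := by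
    simp only [curl3, curl, hcomp, pd_eval_s5, map_sub]
  set a : ℝ := -(1 / ((k : ℝ) * ((k : ℝ) + 1))) with ha
  set Q : MvPolynomial (Fin 3) ℝ := C a * ∑ i, X i * curl P i with hQ
  have hqQ : qOf k p = fun x => eval x Q := by
    funext x
    simp only [qOf, dot3, hcurl, hQ, map_mul, map_sum, eval_C, eval_X, ha]
  have hQgrad (i : Fin 3) : pderiv i Q = C (-(1 / ((k : ℝ) + 1))) * curl P i := by
    rw [hQ, pderiv_C_mul, pderiv_sum_X_mul (IsHomogeneous.curl hP)
      (pderiv_curl_comm hPdiv hPharm), Nat.sub_add_cancel hk, nsmul_eq_mul, ← mul_assoc,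
      ← map_natCast (C : ℝ →+* MvPolynomial (Fin 3) ℝ), ← C_mul, ha]
    congr 2
    field_simp
  have hgrad (x : V3) : grad3 (qOf k p) x = (-(1 / ((k : ℝ) + 1))) • curl3 p x := by
    funext i
    simp only [grad3, hqQ, pd_eval_s5, hQgrad, map_mul, eval_C, Pi.smul_apply, smul_eq_mul, hcurl]
  refine ⟨⟨⟨Q, ?_, fun x => congrFun hqQ x⟩, fun x => ?_⟩, hgrad, fun x => ?_⟩
  · have hsum : (∑ i, X i * curl P i).IsHomogeneous k :=
      IsHomogeneous.sum _ _ _ fun i _ => by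
        simpa [Nat.add_sub_cancel' hk] using (isHomogeneous_X ℝ i).mul (IsHomogeneous.curl hP i)
    simpa using (isHomogeneous_C (Fin 3) a).mul hsum
  · simp only [hqQ, pd_eval_s5, hQgrad, pderiv_C_mul]
    rw [← map_sum, ← Finset.mul_sum, div_curl, mul_zero, map_zero]
  · funext i
    have h := congrArg (eval x) (cross_curl_of_tangential hP hPtan i)
    simp only [map_sub, map_mul, eval_X, map_neg, nsmul_eq_mul, map_natCast] at h
    simp only [hgrad, cross3, Pi.smul_apply, smul_eq_mul, hcurl, hpP]
    field_simp
    push_cast at h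
    linear_combination h
end
end
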